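/- arXiv:1811.08231 — 3 statements merged into one kernel-verified Lean document; each statement's English description precedes it below -/
import Mathlib

section
/- For every d ≥ 0, let p = d · g(3) · g(f(3)) · … · g(f^d(3)) (here the first symbol is the letter d of the alphabet {a,b,c,d,e}) and let s = g(f^d(012)) · g(f^{d-1}(012)) · … · g(f(012)) · g(012) · abcdeac. Then the word T = p·s is a conjugate of g(f^d(01203)) = g(f^{d+1}(0)) and T is not a factor of w₅ = G(F^ω(0)). -/
/-- The morphism F on the alphabet Σ = {0,1,2,3,4}. -/
def F : Fin 5 → List (Fin 5)
  | 0 => [0, 1]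
  | 1 => [2]
  | 2 => [0, 3]
  | 3 => [2, 4]
  | 4 => [2, 3]

/-- Extension of F to words. -/
def Fw (w : List (Fin 5)) : List (Fin 5) := w.flatMap F

/-- `u` is a factor of the fixed point F^ω(0). -/
def FactorF (u : List (Fin 5)) : Prop := ∃ n, u <:+: Fw^[n] [0]

/-- `v` is a conjugate (cyclic rotation) of `u`. -/
def Conj (u v : List (Fin 5)) : Prop := ∃ s t, u = s ++ t ∧ v = t ++ s

/-- The morphism G : Σ* → Δ*, where Δ = {a,b,c,d,e} is coded as
`a = 0, b = 1, c = 2, d = 3, e = 4`. -/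
def G : Fin 5 → List (Fin 5)
  | 0 => [0, 1, 2, 3]      -- abcd
  | 1 => []                -- ε
  | 2 => [4, 0, 2, 3]      -- eacd
  | 3 => [1, 4, 2, 3]      -- becd
  | 4 => [1, 4]            -- be

/-- Extension of G to words. -/
def Gw (w : List (Fin 5)) : List (Fin 5) := w.flatMap G

/-- `u` is a factor of w₅ = G(F^ω(0)). -/
def FactorW5 (u : List (Fin 5)) : Prop := ∃ n, u <:+: Gw (Fw^[n] [0])

/-- The morphism f = F³ on words. -/
def fword (w : List (Fin 5)) : List (Fin 5) := Fw (Fw (Fw w))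

/-- The morphism g = G ∘ F² on words. -/
def gword (w : List (Fin 5)) : List (Fin 5) := Gw (Fw (Fw w))

/-- g(f^k(w)). -/
def gf (k : ℕ) (w : List (Fin 5)) : List (Fin 5) := gword (fword^[k] w)

/-- p = d · g(3) · g(f(3)) · … · g(f^d(3)), where the first symbol is the letter d. -/
def p01203 (d : ℕ) : List (Fin 5) :=
  3 :: ((List.range (d + 1)).map (fun k => gf k [3])).flatten

/-- s = g(f^d(012)) · g(f^{d-1}(012)) · … · g(012) · abcdeac. -/
def s01203 (d : ℕ) : List (Fin 5) :=
  ((List.range (d + 1)).reverse.map (fun k => gf k [0, 1, 2])).flatten ++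
    [0, 1, 2, 3, 4, 0, 2]

/-- A morphism whose images begin with `01`, contain `01` nowhere else and do not end in `0`, so
that the occurrences of `01` in an image word mark the beginnings of the images of letters. -/
structure Synchronizing (h : Fin 5 → List (Fin 5)) : Prop where
  injective : Function.Injective h
  starts : ∀ c, [0, 1] <+: h c
  unique : ∀ c, ¬ [0, 1] <:+: (h c).tail
  last : ∀ c, ¬ [0] <:+ h c

namespace Synchronizing

variable {h : Fin 5 → List (Fin 5)}

theorem ne_nil (hh : Synchronizing h) (c : Fin 5) : h c ≠ [] := by
  obtain ⟨t, ht⟩ := hh.starts c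
  simp [← ht]

theorem eq_nil_of_eq_append (hh : Synchronizing h) {c : Fin 5} {l r : List (Fin 5)}
    (e : h c = l ++ 0 :: 1 :: r) : l = [] := by
  cases l with
  | nil => rfl
  | cons a l => exact (hh.unique c ⟨l, r, by simp [e]⟩).elim

/-- An image word can be cut in front of each occurrence of `01`. -/
theorem exists_split (hh : Synchronizing h) {v l r : List (Fin 5)}
    (e : v.flatMap h = l ++ 0 :: 1 :: r) :
    ∃ v₁ v₂, v = v₁ ++ v₂ ∧ v₁.flatMap h = l ∧ v₂.flatMap h = 0 :: 1 :: r := by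
  induction v generalizing l with
  | nil => simp at e
  | cons c v ih =>
    rw [List.flatMap_cons, List.append_eq_append_iff] at e
    rcases e with ⟨l', rfl, e⟩ | ⟨m, hm, e⟩
    · obtain ⟨v₁, v₂, rfl, rfl, h₂⟩ := ih e
      exact ⟨c :: v₁, v₂, rfl, by simp, h₂⟩
    · match m, e with
      | [], e =>
        obtain ⟨v₁, v₂, rfl, h₁, h₂⟩ := ih (l := []) e.symm
        exact ⟨c :: v₁, v₂, rfl, by simp [h₁, hm], h₂⟩
      | [a], e =>
        obtain ⟨rfl, -⟩ := List.cons.inj e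
        exact (hh.last c ⟨l, hm.symm⟩).elim
      | a :: b :: m, e =>
        obtain ⟨rfl, e'⟩ := List.cons.inj e
        obtain ⟨rfl, e''⟩ := List.cons.inj e'
        obtain rfl := hh.eq_nil_of_eq_append hm
        exact ⟨[], c :: v, rfl, rfl, by simp [hm, e'']⟩

theorem eq_singleton_of_flatMap_eq (hh : Synchronizing h) {c : Fin 5} {v : List (Fin 5)}
    (e : v.flatMap h = h c) : v = [c] := by
  match v, e with
  | [], e => exact (hh.ne_nil c e.symm).elim
  | [a], e => simpa using hh.injective (by simpa using e)
  | a :: b :: v, e =>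
    obtain ⟨t, ht⟩ := hh.starts b
    refine (hh.ne_nil a (hh.eq_nil_of_eq_append (c := c) (r := t ++ v.flatMap h) ?_)).elim
    simp [← e, ← ht]

theorem exists_flatMap_append_eq (hh : Synchronizing h) (u r : List (Fin 5)) :
    ∃ s, u.flatMap h ++ 0 :: 1 :: r = 0 :: 1 :: s := by
  cases u with
  | nil => exact ⟨r, rfl⟩
  | cons b u =>
    obtain ⟨t, ht⟩ := hh.starts b
    exact ⟨t ++ (u.flatMap h ++ 0 :: 1 :: r), by simp [← ht]⟩

/-- Decoding is unique in front of an occurrence of `01`. -/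
theorem exists_eq_append (hh : Synchronizing h) {u v r : List (Fin 5)}
    (e : v.flatMap h = u.flatMap h ++ 0 :: 1 :: r) :
    ∃ v', v = u ++ v' ∧ v'.flatMap h = 0 :: 1 :: r := by
  induction u generalizing v with
  | nil => exact ⟨v, rfl, e⟩
  | cons c u ih =>
    obtain ⟨s, hs⟩ := hh.exists_flatMap_append_eq u r
    rw [List.flatMap_cons, List.append_assoc, hs] at e
    obtain ⟨v₁, v₂, rfl, h₁, h₂⟩ := hh.exists_split e
    obtain rfl := hh.eq_singleton_of_flatMap_eq h₁
    obtain ⟨v', rfl, h'⟩ := ih (h₂.trans hs.symm)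
    exact ⟨v', rfl, h'⟩

/-- An occurrence of `h(u)01` preceded by a letter comes from an occurrence of `u`
between two letters. -/
theorem exists_context (hh : Synchronizing h) {u v l r : List (Fin 5)} {x : Fin 5}
    (e : v.flatMap h = (l ++ [x]) ++ (u.flatMap h ++ 0 :: 1 :: r)) :
    ∃ l' a b r', v = l' ++ a :: (u ++ b :: r') ∧ l'.flatMap h ++ h a = l ++ [x] ∧
      h b ++ r'.flatMap h = 0 :: 1 :: r := by
  obtain ⟨s, hs⟩ := hh.exists_flatMap_append_eq u r
  obtain ⟨v₁, v₂, rfl, h₁, h₂⟩ := hh.exists_split (l := l ++ [x]) (hs ▸ e)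
  obtain ⟨v', rfl, h'⟩ := hh.exists_eq_append (h₂.trans hs.symm)
  rcases List.eq_nil_or_concat v₁ with rfl | ⟨l', a, rfl⟩
  · simp at h₁
  · cases v' with
    | nil => simp at h'
    | cons b r' =>
      exact ⟨l', a, b, r', by simp, by simpa using h₁, by simpa using h'⟩

end Synchronizing

theorem fword_eq_flatMap (w : List (Fin 5)) : fword w = w.flatMap fun c => fword [c] := by
  simp [fword, Fw, List.flatMap_assoc]

theorem gword_eq_flatMap (w : List (Fin 5)) : gword w = w.flatMap fun c => gword [c] := by
  simp [gword, Gw, Fw, List.flatMap_assoc]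

theorem synchronizing_fword : Synchronizing fun c => fword [c] where
  injective := by decide
  starts := by decide
  unique := by decide
  last := by decide

theorem synchronizing_gword : Synchronizing fun c => gword [c] where
  injective := by decide
  starts := by decide
  unique := by decide
  last := by decide

theorem fword_append (u v : List (Fin 5)) : fword (u ++ v) = fword u ++ fword v := by
  simp [fword, Fw]

theorem gword_append (u v : List (Fin 5)) : gword (u ++ v) = gword u ++ gword v := by
  simp [gword, Gw, Fw]

theorem fword_iterate_append (k : ℕ) (u v : List (Fin 5)) :
    fword^[k] (u ++ v) = fword^[k] u ++ fword^[k] v := by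
  induction k generalizing u v with
  | zero => rfl
  | succ k ih => simp [fword_append, ih]

theorem gf_append (k : ℕ) (u v : List (Fin 5)) : gf k (u ++ v) = gf k u ++ gf k v := by
  simp [gf, fword_iterate_append, gword_append]

/-- The word `3 f(3) ⋯ fⁿ⁻¹(3) fⁿ⁻¹(012) ⋯ f(012) 012`. -/
def core : ℕ → List (Fin 5)
  | 0 => []
  | n + 1 => 3 :: (fword (core n) ++ [0, 1, 2])

theorem core_eq (n : ℕ) : core n = ((List.range n).map fun k => fword^[k] [3]).flatten ++
    ((List.range n).reverse.map fun k => fword^[k] [0, 1, 2]).flatten := by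
  have fword_flatten (L : List (List (Fin 5))) : fword L.flatten = (L.map fword).flatten := by
    induction L with
    | nil => rfl
    | cons u L ih => simp [fword_append, ih]
  induction n with
  | zero => rfl
  | succ n ih =>
    rw [core, ih, fword_append, fword_flatten, fword_flatten, List.range_succ_eq_map]
    simp [Function.comp_def, -List.range_map_iterate, -Function.iterate_succ,
      Function.iterate_succ_apply' fword]

theorem p_append_s_eq (d : ℕ) :
    p01203 d ++ s01203 d = 3 :: (gword (core (d + 1)) ++ [0, 1, 2, 3, 4, 0, 2]) := by
  have gword_flatten (L : List (List (Fin 5))) : gword L.flatten = (L.map gword).flatten := by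
    induction L with
    | nil => rfl
    | cons u L ih => simp [gword_append, ih]
  rw [core_eq, gword_append, gword_flatten, gword_flatten]
  simp [p01203, s01203, gf, Function.comp_def, -List.range_map_iterate]

theorem s_append_p_eq (d : ℕ) : gf d [0, 1, 2, 0, 3] = s01203 d ++ p01203 d := by
  induction d with
  | zero => decide
  | succ d ih =>
    have hs : s01203 (d + 1) = gf (d + 1) [0, 1, 2] ++ s01203 d := by
      simp [s01203, List.range_succ]
    have hp : p01203 (d + 1) = p01203 d ++ gf (d + 1) [3] := by
      simp [p01203, List.range_succ]
    have h0 : gf (d + 1) [0] = gf d [0, 1, 2, 0, 3] := by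
      rw [gf, Function.iterate_succ_apply]; rfl
    rw [show ([0, 1, 2, 0, 3] : List (Fin 5)) = [0, 1, 2] ++ [0] ++ [3] from rfl,
      gf_append, gf_append, h0, ih, hs, hp]
    simp

/-- In an image under `f`, the letter `0` is followed by neither `0` nor `2`. -/
theorem isChain_fword (v : List (Fin 5)) :
    (fword v).IsChain fun x y => x = 0 → y ≠ 0 ∧ y ≠ 2 := by
  rw [fword_eq_flatMap]
  induction v with
  | nil => simp
  | cons c v ih =>
    rw [List.flatMap_cons, List.isChain_append]
    have hc : ∀ c : Fin 5, (fword [c]).IsChain (fun x y => x = 0 → y ≠ 0 ∧ y ≠ 2) ∧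
        ∀ x ∈ (fword [c]).getLast?, x ≠ 0 := by decide
    exact ⟨(hc c).1, ih, fun x hx y _ h0 => ((hc c).2 x hx h0).elim⟩

theorem fword_context {u v l r : List (Fin 5)} {x y : Fin 5} (hx : x ≠ 2)
    (hx' : x ≠ 4) (hy : y = 0 ∨ y = 2)
    (e : fword v = l ++ x :: 3 :: (fword u ++ 0 :: 1 :: 2 :: y :: r)) :
    x = 0 ∧ ∃ l' b r', (b = 0 ∨ b = 2) ∧ v = l' ++ 0 :: (u ++ b :: r') := by
  rw [fword_eq_flatMap v, fword_eq_flatMap u] at e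
  obtain ⟨l', a, b, r', hv, ha, hb⟩ :=
    synchronizing_fword.exists_context (l := l ++ [x]) (x := 3) (u := u)
      (r := 2 :: y :: r) (by simpa using e)
  have hb' : b = 0 ∨ b = 2 := by
    have := congrArg (List.take 4) hb
    have h4 : ∀ b : Fin 5, 4 ≤ (fword [b]).length := by decide
    rw [List.take_append_of_le_length (h4 b)] at this
    simp only [List.take_succ_cons, List.take_zero] at this
    clear e hb hv
    revert b y
    decide
  have ha' : (fword [a]).drop ((fword [a]).length - 2) = [x, 3] := by
    have h2 : ∀ a : Fin 5, 2 ≤ (fword [a]).length := by decide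
    have := congrArg (fun w => w.reverse.take 2) ha
    simp only [List.reverse_append, List.append_assoc] at this
    rw [List.take_append_of_le_length (by simpa using h2 a), List.take_reverse] at this
    simpa using congrArg List.reverse this
  have hxa : x = 0 ∧ a = 0 := by
    clear e ha hv hb
    revert a x
    decide
  exact ⟨hxa.1, l', b, r', hb', by rw [hv, hxa.2]⟩

theorem core_not_factor (n m : ℕ) (l r : List (Fin 5)) (y : Fin 5) (hy : y = 0 ∨ y = 2) :
    fword^[m] [0] ≠ l ++ 0 :: (core n ++ y :: r) := by
  intro e
  induction n generalizing m l r y with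
  | zero =>
    cases m with
    | zero =>
      have := congrArg List.length e
      simp at this
      lia
    | succ m =>
      have := isChain_fword (fword^[m] [0])
      rw [← Function.iterate_succ_apply' fword, e, List.isChain_append] at this
      simp only [core, List.nil_append, List.isChain_cons_cons] at this
      have := this.2.1.1 trivial
      tauto
  | succ n ih =>
    cases m with
    | zero =>
      have := congrArg List.length e
      simp at this
      lia
    | succ m =>
      rw [Function.iterate_succ_apply'] at e
      obtain ⟨-, l', b, r', hb, hv⟩ := fword_context (u := core n) (l := l) (x := 0) (y := y)
        (r := r) (by decide) (by decide) hy (by simpa [core] using e)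
      exact ih m l' r' b hb hv

theorem Fw_append (u v : List (Fin 5)) : Fw (u ++ v) = Fw u ++ Fw v := by
  simp [Fw]

theorem Fw_iterate_mono {m n : ℕ} (hmn : m ≤ n) : Fw^[m] [0] <+: Fw^[n] [0] := by
  induction n, hmn using Nat.le_induction with
  | base => exact List.prefix_refl _
  | succ n _ ih =>
    have hstep : ∀ k, Fw^[k] [0] <+: Fw^[k + 1] [0] := by
      intro k
      induction k with
      | zero => exact ⟨[1], rfl⟩
      | succ k ih =>
        obtain ⟨t, ht⟩ := ih
        exact ⟨Fw t, by rw [Function.iterate_succ_apply' Fw (k + 1), Function.iterate_succ_apply',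
          ← Fw_append, ht, Function.iterate_succ_apply']⟩
    exact ih.trans (hstep n)

theorem FactorW5.exists_gword {u : List (Fin 5)} (hu : FactorW5 u) :
    ∃ m, u <:+: gword (fword^[m + 1] [0]) := by
  obtain ⟨n, hn⟩ := hu
  refine ⟨n, hn.trans ?_⟩
  obtain ⟨t, ht⟩ := Fw_iterate_mono (show n ≤ 2 + 3 * (n + 1) by lia)
  have hf : fword^[n + 1] [0] = Fw^[3 * (n + 1)] [0] := by
    rw [Function.iterate_mul]; rfl
  have : gword (fword^[n + 1] [0]) = Gw (Fw^[n] [0]) ++ Gw t := by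
    rw [hf, gword, ← Function.iterate_succ_apply' Fw, ← Function.iterate_succ_apply' Fw,
      show (3 * (n + 1)).succ.succ = 2 + 3 * (n + 1) by lia, ← ht]
    simp [Gw]
  rw [this]
  exact (List.prefix_append _ _).isInfix

theorem gword_context {u v l r : List (Fin 5)}
    (e : gword v = l ++ 3 :: (gword u ++ [0, 1, 2, 3, 4, 0, 2] ++ r)) :
    ∃ l' a b r', a ≠ 2 ∧ a ≠ 4 ∧ (b = 0 ∨ b = 2) ∧ v = l' ++ a :: (u ++ b :: r') := by
  rw [gword_eq_flatMap v, gword_eq_flatMap u] at e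
  obtain ⟨l', a, b, r', hv, ha, hb⟩ :=
    synchronizing_gword.exists_context (l := l) (x := 3) (u := u)
      (r := [2, 3, 4, 0, 2] ++ r) (by simpa using e)
  have hb' : b = 0 ∨ b = 2 := by
    have := congrArg (List.take 7) hb
    have h7 : ∀ b : Fin 5, 7 ≤ (gword [b]).length := by decide
    rw [List.take_append_of_le_length (h7 b)] at this
    simp only [List.cons_append, List.take_succ_cons, List.take_zero, List.nil_append] at this
    clear hb hv
    revert b
    decide
  have ha' : (gword [a]).getLast? = some 3 := by
    have := congrArg List.getLast? ha
    rw [List.getLast?_append_of_ne_nil _ (synchronizing_gword.ne_nil a)] at this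
    simpa using this
  have ha'' : a ≠ 2 ∧ a ≠ 4 := by
    clear ha hv
    revert a
    decide
  exact ⟨l', a, b, r', ha''.1, ha''.2, hb', hv⟩

theorem conj_gf_01203_not_factor (d : ℕ) :
    Conj (gf d [0, 1, 2, 0, 3]) (p01203 d ++ s01203 d) ∧
    ¬ FactorW5 (p01203 d ++ s01203 d) := by
  refine ⟨⟨s01203 d, p01203 d, s_append_p_eq d, rfl⟩, fun hT => ?_⟩
  obtain ⟨m, l, r, e⟩ := hT.exists_gword
  rw [p_append_s_eq] at e
  obtain ⟨l', a, b, r', ha, ha', hb, hv⟩ := gword_context (u := core (d + 1)) (l := l) (r := r)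
    (by simpa using e.symm)
  have hv' := (Function.iterate_succ_apply' fword m [0]).symm.trans hv
  obtain ⟨rfl, -⟩ := fword_context (u := core d) (l := l') (r := r') ha ha' hb
    (by simpa [core] using hv')
  exact core_not_factor (d + 1) (m + 1) l' r' b hb hv
end

section
/- The word 232 is not a factor of the fixed point F^ω(0). -/
/-- The image of a nonempty word begins with `0` or `2`. -/
theorem Fw_cons_head (a : Fin 5) (w : List (Fin 5)) :
    ∃ c v, Fw (a :: w) = c :: v ∧ (c = 0 ∨ c = 2) := by
  fin_cases a <;> simp [Fw, F]

/-- In any image under `F`, the letter `4` is followed only by `0` or `2`. -/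
theorem isChain_Fw (w : List (Fin 5)) :
    (Fw w).IsChain (fun a b => a = 4 → b = 0 ∨ b = 2) := by
  induction w with
  | nil => simp [Fw]
  | cons a w ih =>
    have hcons : Fw (a :: w) = F a ++ Fw w := by simp [Fw]
    rw [hcons, List.isChain_append]
    refine ⟨by fin_cases a <;> simp [F], ih, fun x _ y hy _ => ?_⟩
    cases w with
    | nil => simp [Fw] at hy
    | cons b w =>
      obtain ⟨c, v, hv, hc⟩ := Fw_cons_head b w
      simp only [hv, List.head?_cons, Option.mem_some_iff] at hy
      exact hy ▸ hc

/-- If `4` is followed only by `0` or `2` in `w`, then `232` is not a factor of the image of `w`. -/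
theorem not_infix_Fw {w : List (Fin 5)}
    (hw : w.IsChain (fun a b => a = 4 → b = 0 ∨ b = 2)) : ¬ [2, 3, 2] <:+: Fw w := by
  induction w with
  | nil => simp [Fw]
  | cons a w ih =>
    have hcons : Fw (a :: w) = F a ++ Fw w := by simp [Fw]
    have ih := ih hw.tail
    rw [hcons]
    cases w with
    | nil => fin_cases a <;> simp [F, Fw, List.infix_cons_iff]
    | cons b w =>
      have hab := (List.isChain_cons_cons.mp hw).1
      obtain ⟨c, v, hv, hc⟩ := Fw_cons_head b w
      have hb : b = 0 ∨ b = 2 → c = 0 := by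
        rintro (rfl | rfl) <;> simp [Fw, F] at hv <;> exact hv.1.symm
      rw [hv] at ih ⊢
      fin_cases a <;> simp_all [F, List.infix_cons_iff, List.cons_prefix_cons]
      rcases hc with rfl | rfl <;> simp_all

theorem not_factor_232 : ¬ FactorF [2, 3, 2] := by
  rintro ⟨n, hn⟩
  cases n with
  | zero => simp [List.infix_cons_iff] at hn
  | succ n =>
    rw [Function.iterate_succ_apply'] at hn
    refine not_infix_Fw ?_ hn
    cases n with
    | zero => simp
    | succ n =>
      rw [Function.iterate_succ_apply']
      exact isChain_Fw _
end

section
/- The word 32403 is not a factor of the fixed point F^ω(0). -/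
/-- A relation on consecutive letters that `F` preserves: `4` can only be followed by `0`,
and `3` only by `0` or `2`. -/
def Follows (a b : Fin 5) : Prop := (a = 4 → b = 0) ∧ (a = 3 → b = 0 ∨ b = 2)

instance : DecidableRel Follows := fun _ _ => inferInstanceAs (Decidable (_ ∧ _))

theorem Fw_nil : Fw [] = [] := rfl

theorem Fw_cons (a : Fin 5) (t : List (Fin 5)) : Fw (a :: t) = F a ++ Fw t := rfl

theorem isChain_follows_Fw {w : List (Fin 5)} (h : w.IsChain Follows) :
    (Fw w).IsChain Follows := by
  have hne : [] ∉ w.map F := by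
    have : ∀ a, F a ≠ [] := by decide
    simpa using fun a _ => this a
  rw [Fw, List.flatMap_def, List.isChain_flatten hne, List.isChain_map]
  refine ⟨?_, h.imp ?_⟩
  · have : ∀ a, (F a).IsChain Follows := by decide
    simpa using fun a _ => this a
  · decide

theorem isChain_follows_iterate (n : ℕ) : (Fw^[n] [0]).IsChain Follows := by
  induction n with
  | zero => simp
  | succ n ih =>
    rw [Function.iterate_succ_apply']
    exact isChain_follows_Fw ih

theorem not_infix_Fw_232 {w : List (Fin 5)} (h : w.IsChain Follows) :
    ¬ [2, 3, 2] <:+: Fw w := by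
  induction w with
  | nil => simp [Fw_nil]
  | cons a t ih =>
    have ih := ih h.tail
    rcases t with _ | ⟨b, t⟩
    · fin_cases a <;> simp [Fw_nil, Fw_cons, F, List.infix_cons_iff]
    · have hab := h.rel
      rw [Fw_cons]
      fin_cases a <;> fin_cases b <;>
        simp_all [Follows, Fw_cons, F, List.infix_cons_iff]

theorem prefix_of_2403_prefix_Fw {w : List (Fin 5)} (h : [2, 4, 0, 3] <+: Fw w) :
    [3, 2] <+: w := by
  rcases w with _ | ⟨a, _ | ⟨b, t⟩⟩
  · simp [Fw_nil] at h
  · fin_cases a <;> simp [Fw_nil, Fw_cons, F] at h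
  · fin_cases a <;> fin_cases b <;> simp_all [Fw_cons, F]

theorem infix_of_32403_infix_Fw {w : List (Fin 5)} (h : [3, 2, 4, 0, 3] <:+: Fw w) :
    [2, 3, 2] <:+: w ∨ [4, 3, 2] <:+: w := by
  induction w with
  | nil => simp [Fw_nil] at h
  | cons a t ih =>
    have key := prefix_of_2403_prefix_Fw (w := t)
    rw [Fw_cons] at h
    rw [List.infix_cons_iff, List.infix_cons_iff]
    fin_cases a <;> simp [F, List.infix_cons_iff] at h ⊢ <;> tauto

theorem not_factor_32403 : ¬ FactorF [3, 2, 4, 0, 3] := by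
  rintro ⟨_ | _ | n, h⟩
  · simp [List.infix_cons_iff] at h
  · exact absurd h (by decide)
  · rw [Function.iterate_succ_apply'] at h
    rcases infix_of_32403_infix_Fw h with h | h
    · rw [Function.iterate_succ_apply'] at h
      exact not_infix_Fw_232 (isChain_follows_iterate n) h
    · obtain ⟨s, t, h⟩ := h
      have hc := isChain_follows_iterate (n + 1)
      rw [← h] at hc
      exact absurd hc.left_of_append.right_of_append (by decide)
end
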